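/- Let I > 0 and γ ≠ 0, and set b := −γ and a := −I/γ (so ab = I/... > 0, i.e., ab > 0). Then the Mirollo–Strogatz rise function with parameters a, b is the inverse of the leaky integrate-and-fire rise function with parameters I, γ: for every φ ∈ ℝ, the value U_IF(φ) = (I/γ)(1 − e^{−γφ}) lies in the domain of U_MS (i.e., 1 + U_IF(φ)/a = e^{−γφ} > 0) and U_MS(U_IF(φ)) = b⁻¹·ln(1 + U_IF(φ)/a) = φ. Equivalently, (1/b)·ln(1 + x/a) = −(1/γ)·ln(1 − γx/I) = U_IF⁻¹(x) for all x with 1 − γx/I > 0. -/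

import Mathlib

/-- For `I > 0`, `γ ≠ 0`, setting `b := -γ`, `a := -I/γ` (so `a b > 0`), the
Mirollo–Strogatz rise function with parameters `a, b` is the inverse of the leaky
integrate-and-fire rise function with parameters `I, γ`: for every `φ`,
`1 + U_IF(φ)/a = e^{-γφ} > 0` and `U_MS(U_IF(φ)) = b⁻¹ ln(1 + U_IF(φ)/a) = φ`.
Equivalently, `(1/b) ln(1 + x/a) = -(1/γ) ln(1 - γ x / I)` for all `x` with
`1 - γ x / I > 0`. -/
theorem ms_is_inverse_of_lif (I γ a b : ℝ) (hI : 0 < I) (hγ : γ ≠ 0)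
    (hb : b = -γ) (ha : a = -I / γ)
    (UIF : ℝ → ℝ) (hUIF : ∀ φ, UIF φ = (I / γ) * (1 - Real.exp (-γ * φ)))
    (UMS : ℝ → ℝ) (hUMS : ∀ x, UMS x = b⁻¹ * Real.log (1 + x / a)) :
    0 < a * b ∧
    (∀ φ : ℝ,
      1 + UIF φ / a = Real.exp (-γ * φ) ∧
      0 < 1 + UIF φ / a ∧
      UMS (UIF φ) = φ) ∧
    (∀ x : ℝ, 0 < 1 - γ * x / I →
      (1 / b) * Real.log (1 + x / a) = -(1 / γ) * Real.log (1 - γ * x / I)) := by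
  have hI' : I ≠ 0 := hI.ne'
  have key : ∀ x : ℝ, 1 + x / a = 1 - γ * x / I := by
    intro x
    rw [ha]
    field_simp
    ring
  have h1 : ∀ φ : ℝ, 1 + UIF φ / a = Real.exp (-γ * φ) := by
    intro φ
    rw [key, hUIF]
    field_simp
    ring
  refine ⟨?_, fun φ => ⟨h1 φ, ?_, ?_⟩, fun x _ => ?_⟩
  · have : a * b = I := by
      rw [ha, hb]
      field_simp
    rw [this]
    exact hI
  · rw [h1]
    exact Real.exp_pos _
  · rw [hUMS, h1, Real.log_exp, hb]
    field_simp
  · rw [key, hb, one_div, one_div, inv_neg]
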